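/- The bicyclic monoid ℬ and the monoid UT_2(𝕋) satisfy exactly the same semigroup identities: for every finite alphabet Σ and all w, v ∈ Σ⁺, the identity w = v holds in ℬ if and only if it holds in UT_2(𝕋). -/

import Mathlib

/-- The tropical (max-plus) semiring `𝕋 = ℝ ∪ {-∞}`, with `⊕ = max` and `⊗ = +`. -/
abbrev TT : Type := WithBot ℝ

/-- Tropical (max-plus) multiplication of square matrices over `𝕋`:
`(A ⊗ B) i j = max_k (A i k + B k j)`. -/
def tmul {ι : Type} [Fintype ι] (A B : Matrix ι ι TT) : Matrix ι ι TT :=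
  fun i j => Finset.univ.sup fun k => A i k + B k j

/-- The image of a word under the semigroup homomorphism from the free semigroup `Σ⁺`
to tropical matrices determined by the letter assignment `a` (junk value on the empty word). -/
def evalWord {ι σ : Type} [Fintype ι] (a : σ → Matrix ι ι TT) : List σ → Matrix ι ι TT
  | [] => fun _ _ => ⊥
  | h :: t => t.foldl (fun M s => tmul M (a s)) (a h)

/-- A tropical matrix is upper triangular if all entries strictly below the diagonal are `-∞`. -/
def IsUT {n : ℕ} (A : Matrix (Fin n) (Fin n) TT) : Prop :=
  ∀ i j : Fin n, j < i → A i j = ⊥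

/-- Multiplication of the bicyclic monoid `ℬ = ℕ₀ × ℕ₀`:
`(a,b)(c,d) = (a - b + max(b,c), d - c + max(b,c))` (in `ℕ` written with truncated
subtraction as `(a + (max b c - b), d + (max b c - c))`, which agrees since `max b c ≥ b, c`). -/
def bmul (p q : ℕ × ℕ) : ℕ × ℕ :=
  (p.1 + (max p.2 q.1 - p.2), q.2 + (max p.2 q.1 - q.1))

/-- The image of a word under the semigroup homomorphism `Σ⁺ → ℬ` determined by the letter
assignment `a` (junk value on the empty word). -/
def evalWordB {σ : Type} (a : σ → ℕ × ℕ) : List σ → ℕ × ℕ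
  | [] => (0, 0)
  | h :: t => t.foldl (fun m s => bmul m (a s)) (a h)

open Filter Topology

/-- The inclusion of `𝕋 = ℝ ∪ {-∞}` into the extended reals. -/
noncomputable def TT.toEReal (x : TT) : EReal :=
  WithBot.recBotCoe ⊥ (fun r : ℝ => (r : EReal)) x

@[simp] lemma TT.toEReal_bot : TT.toEReal ⊥ = ⊥ := rfl

@[simp] lemma TT.toEReal_coe (r : ℝ) : TT.toEReal (r : TT) = (r : EReal) := rfl

lemma TT.toEReal_ne_top (x : TT) : x.toEReal ≠ ⊤ := by
  induction x using WithBot.recBotCoe <;> simp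

lemma TT.toEReal_injective : Function.Injective TT.toEReal := by
  intro x y h
  induction x using WithBot.recBotCoe <;> induction y using WithBot.recBotCoe <;> simp_all

lemma TT.toEReal_add (x y : TT) : (x + y).toEReal = x.toEReal + y.toEReal := by
  induction x using WithBot.recBotCoe <;> induction y using WithBot.recBotCoe <;>
    simp [← WithBot.coe_add]

lemma TT.toEReal_monotone : Monotone TT.toEReal := by
  intro x y h
  induction x using WithBot.recBotCoe <;> induction y using WithBot.recBotCoe <;> simp_all

lemma TT.exists_int_tendsto (x : TT) : ∃ m : ℕ → ℤ,
    Tendsto (fun N : ℕ => TT.toEReal ((((N : ℝ) + 1)⁻¹ * m N : ℝ) : TT)) atTop (𝓝 x.toEReal) := by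
  induction x using WithBot.recBotCoe with
  | bot =>
    refine ⟨fun N => -((N : ℤ) + 1) ^ 2, ?_⟩
    simp only [TT.toEReal_coe, TT.toEReal_bot]
    refine EReal.tendsto_coe_nhds_bot_iff.2 ?_
    have h : Tendsto (fun N : ℕ => -((N : ℝ) + 1)) atTop atBot :=
      tendsto_neg_atTop_atBot.comp
        (tendsto_atTop_add_const_right _ _ tendsto_natCast_atTop_atTop)
    refine h.congr fun N => ?_
    have : (N : ℝ) + 1 ≠ 0 := by positivity
    push_cast
    field_simp
  | coe r =>
    refine ⟨fun N => ⌊r * ((N : ℝ) + 1)⌋, ?_⟩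
    simp only [TT.toEReal_coe]
    refine (continuous_coe_real_ereal.tendsto r).comp ?_
    have h1 : Tendsto (fun N : ℕ => r - ((N : ℝ) + 1)⁻¹) atTop (𝓝 r) := by
      simpa using tendsto_const_nhds.sub (tendsto_one_div_add_atTop_nhds_zero_nat (𝕜 := ℝ))
    refine tendsto_of_tendsto_of_tendsto_of_le_of_le h1 tendsto_const_nhds
      (fun N => ?_) (fun N => ?_)
    · have hN : (0 : ℝ) < (N : ℝ) + 1 := by positivity
      have := Int.sub_one_lt_floor (r * ((N : ℝ) + 1))
      calc r - ((N : ℝ) + 1)⁻¹ = ((N : ℝ) + 1)⁻¹ * (r * ((N : ℝ) + 1) - 1) := by field_simp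
        _ ≤ _ := by gcongr
    · have hN : (0 : ℝ) < (N : ℝ) + 1 := by positivity
      have := Int.floor_le (r * ((N : ℝ) + 1))
      calc ((N : ℝ) + 1)⁻¹ * (⌊r * ((N : ℝ) + 1)⌋ : ℝ)
          ≤ ((N : ℝ) + 1)⁻¹ * (r * ((N : ℝ) + 1)) := by gcongr
        _ = r := by field_simp

/-- Entrywise convergence of tropical matrices, tested in the extended reals. -/
def TropTendsto {ι : Type} (A : ℕ → Matrix ι ι TT) (B : Matrix ι ι TT) : Prop :=
  ∀ i j, Tendsto (fun N => (A N i j).toEReal) atTop (𝓝 (B i j).toEReal)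

lemma TropTendsto.eq {ι : Type} {A : ℕ → Matrix ι ι TT} {B C : Matrix ι ι TT}
    (hB : TropTendsto A B) (hC : TropTendsto A C) : B = C := by
  funext i j
  exact TT.toEReal_injective (tendsto_nhds_unique (hB i j) (hC i j))

lemma toEReal_tmul {ι : Type} [Fintype ι] (A B : Matrix ι ι TT) (i j : ι) :
    (tmul A B i j).toEReal =
      Finset.univ.sup fun k => (A i k).toEReal + (B k j).toEReal := by
  unfold tmul
  rw [Finset.apply_sup_eq_sup_comp_of_linearOrder _ TT.toEReal_monotone rfl]
  simp only [Function.comp_def, TT.toEReal_add]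

lemma TropTendsto.tmul {ι : Type} [Fintype ι] {A A' : ℕ → Matrix ι ι TT} {B B' : Matrix ι ι TT}
    (h : TropTendsto A B) (h' : TropTendsto A' B') :
    TropTendsto (fun N => tmul (A N) (A' N)) (tmul B B') := by
  intro i j
  simp only [toEReal_tmul]
  refine Tendsto.finset_sup_nhds_apply fun k _ => ?_
  exact (EReal.continuousAt_add (p := ((B i k).toEReal, (B' k j).toEReal))
    (Or.inl (TT.toEReal_ne_top _)) (Or.inr (TT.toEReal_ne_top _))).tendsto.comp
      ((h i k).prodMk_nhds (h' k j))

lemma TropTendsto.evalWord {ι σ : Type} [Fintype ι] {A : ℕ → σ → Matrix ι ι TT}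
    {B : σ → Matrix ι ι TT} (h : ∀ s, TropTendsto (fun N => A N s) (B s)) (w : List σ) :
    TropTendsto (fun N => evalWord (A N) w) (evalWord B w) := by
  have key : ∀ (t : List σ) (M : ℕ → Matrix ι ι TT) (M' : Matrix ι ι TT), TropTendsto M M' →
      TropTendsto (fun N => t.foldl (fun M s => _root_.tmul M (A N s)) (M N))
        (t.foldl (fun M s => _root_.tmul M (B s)) M') := by
    intro t
    induction t with
    | nil => exact fun _ _ hM => hM
    | cons s t ih => exact fun M M' hM => ih _ _ (hM.tmul (h s))
  cases w with
  | nil => exact fun _ _ => tendsto_const_nhds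
  | cons s t => exact key t _ _ (h s)

/-- The upper triangular tropical matrix attached to an element of the bicyclic monoid,
with scaling factor `k`, shift `c` of the corner entry, and scalar multiplier `z`. -/
noncomputable def bicyclicMatrix (k c z : ℝ) (p : ℕ × ℕ) : Matrix (Fin 2) (Fin 2) TT :=
  !![((k * ((p.1 : ℝ) - p.2) + z : ℝ) : TT), ((k * ((p.1 : ℝ) - c) + z : ℝ) : TT);
    ⊥, ((z : ℝ) : TT)]

lemma isUT_of_fin_two {a b d : TT} : IsUT !![a, b; ⊥, d] := by
  intro i j h
  fin_cases i <;> fin_cases j <;> simp_all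

lemma tmul_bicyclicMatrix {k : ℝ} (hk : 0 ≤ k) (c z z' : ℝ) (p q : ℕ × ℕ) :
    tmul (bicyclicMatrix k c z p) (bicyclicMatrix k c z' q) =
      bicyclicMatrix k c (z + z') (bmul p q) := by
  obtain ⟨a, b⟩ := p
  obtain ⟨a', b'⟩ := q
  funext i j
  fin_cases i <;> fin_cases j <;>
    simp only [tmul, bicyclicMatrix, bmul, Fin.univ_succ, Finset.sup_cons, Finset.univ_unique,
      Finset.map_singleton, Finset.sup_singleton, Matrix.of_apply, Matrix.cons_val', Fin.isValue,
      Fin.zero_eta, Fin.mk_one, Matrix.cons_val_zero, Matrix.cons_val_one, Fin.default_eq_zero,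
      Function.Embedding.coeFn_mk, Fin.succ_zero_eq_one, WithBot.add_bot, WithBot.bot_add,
      ← WithBot.coe_add, ← WithBot.coe_max, bot_sup_eq, sup_bot_eq, WithBot.coe_inj]
  · rcases le_total b a' with h | h <;> simp [h] <;> ring
  · rcases le_total b a' with h | h
    · have : (b : ℝ) ≤ a' := by exact_mod_cast h
      rw [max_eq_left (by nlinarith)]
      simp [h]
      ring
    · have : (a' : ℝ) ≤ b := by exact_mod_cast h
      rw [max_eq_right (by nlinarith)]
      simp [h]
      ring

lemma evalWord_bicyclicMatrix {σ : Type} {k : ℝ} (hk : 0 ≤ k) (c : ℝ) (z : σ → ℝ)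
    (a : σ → ℕ × ℕ) {w : List σ} (hw : w ≠ []) :
    evalWord (fun s => bicyclicMatrix k c (z s) (a s)) w =
      bicyclicMatrix k c (w.map z).sum (evalWordB a w) := by
  have key : ∀ (t : List σ) (r : ℝ) (p : ℕ × ℕ),
      t.foldl (fun M s => tmul M (bicyclicMatrix k c (z s) (a s))) (bicyclicMatrix k c r p) =
        bicyclicMatrix k c (r + (t.map z).sum) (t.foldl (fun m s => bmul m (a s)) p) := by
    intro t
    induction t with
    | nil => simp
    | cons s t ih =>
      intro r p
      simp only [List.foldl_cons, tmul_bicyclicMatrix hk, ih, List.map_cons, List.sum_cons,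
        add_assoc]
  cases w with
  | nil => exact absurd rfl hw
  | cons s t => simpa [evalWord, evalWordB] using key t (z s) (a s)

lemma bicyclicMatrix_injective : Function.Injective (bicyclicMatrix 1 0 0) := by
  intro p q h
  have h0 := congrFun (congrFun h 0) 0
  have h1 := congrFun (congrFun h 0) 1
  simp only [bicyclicMatrix, Matrix.of_apply, Matrix.cons_val', Matrix.cons_val_zero,
    Matrix.cons_val_one, WithBot.coe_inj, one_mul, add_zero, sub_zero, Fin.isValue] at h0 h1
  rw [h1] at h0
  exact Prod.ext (by exact_mod_cast h1) (by exact_mod_cast sub_right_injective h0)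

lemma evalWordB_count {σ : Type} [DecidableEq σ] (s : σ) (w : List σ) :
    evalWordB (fun u => if u = s then (1, 0) else (0, 0)) w = (w.count s, 0) := by
  have key : ∀ (t : List σ) (n : ℕ),
      t.foldl (fun m u => bmul m (if u = s then (1, 0) else (0, 0))) (n, 0) =
        (n + t.count s, 0) := by
    intro t
    induction t with
    | nil => simp
    | cons u t ih =>
      intro n
      by_cases h : u = s
      · simp [h, bmul] at ih ⊢
        rw [ih]
        simp; ring
      · simpa [h, bmul] using ih n
  cases w with
  | nil => rfl
  | cons u t =>
    by_cases h : u = s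
    · simpa [evalWordB, h, add_comm] using key t 1
    · simpa [evalWordB, h] using key t 0

/-- An identity of the bicyclic monoid holds for upper triangular matrices whose finite
entries are integer multiples of a common nonnegative real. -/
lemma evalWord_eq_of_int {σ : Type} [Fintype σ] {w v : List σ} (hw : w ≠ []) (hv : v ≠ [])
    (h : ∀ a : σ → ℕ × ℕ, evalWordB a w = evalWordB a v) {k : ℝ} (hk : 0 ≤ k)
    (x y z : σ → ℤ) :
    evalWord (fun s => !![((k * x s : ℝ) : TT), ((k * y s : ℝ) : TT);
      ⊥, ((k * z s : ℝ) : TT)]) w =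
    evalWord (fun s => !![((k * x s : ℝ) : TT), ((k * y s : ℝ) : TT);
      ⊥, ((k * z s : ℝ) : TT)]) v := by
  classical
  have hperm : w.Perm v := List.perm_iff_count.2 fun s => by
    simpa [evalWordB_count] using h fun u => if u = s then (1, 0) else (0, 0)
  obtain ⟨c, hc⟩ := (Set.finite_range fun s => max (z s - y s) (x s - y s)).bddAbove
  have hc' : ∀ s, z s - y s ≤ c ∧ x s - y s ≤ c := fun s =>
    max_le_iff.1 (hc (Set.mem_range_self s))
  set a : σ → ℕ × ℕ := fun s => ((y s - z s + c).toNat, (y s - x s + c).toNat) with ha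
  have hA : (fun s => !![((k * x s : ℝ) : TT), ((k * y s : ℝ) : TT);
      ⊥, ((k * z s : ℝ) : TT)]) = fun s => bicyclicMatrix k c (k * z s) (a s) := by
    funext s
    have h1 : (((a s).1 : ℕ) : ℝ) = y s - z s + c := by
      have : (((a s).1 : ℕ) : ℤ) = y s - z s + c := Int.toNat_of_nonneg (by linarith [hc' s])
      exact_mod_cast this
    have h2 : (((a s).2 : ℕ) : ℝ) = y s - x s + c := by
      have : (((a s).2 : ℕ) : ℤ) = y s - x s + c := Int.toNat_of_nonneg (by linarith [hc' s])
      exact_mod_cast this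
    rw [bicyclicMatrix, h1, h2]
    congr 5 <;> ring_nf
  rw [hA, evalWord_bicyclicMatrix hk _ _ _ hw, evalWord_bicyclicMatrix hk _ _ _ hv, h a,
    (hperm.map _).sum_eq]

/-- The bicyclic monoid `ℬ` and `UT_2(𝕋)` satisfy exactly the same semigroup
identities: for all nonempty words `w, v` over a finite alphabet `Σ`, the identity `w = v`
holds in `ℬ` iff it holds in `UT_2(𝕋)`. -/
theorem stmt_9 (σ : Type) [Fintype σ] (w v : List σ) (hw : w ≠ []) (hv : v ≠ []) :
    (∀ a : σ → ℕ × ℕ, evalWordB a w = evalWordB a v)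
    ↔ (∀ a : σ → Matrix (Fin 2) (Fin 2) TT, (∀ s, IsUT (a s)) →
        evalWord a w = evalWord a v) := by
  constructor
  · intro h A hA
    choose m hm using TT.exists_int_tendsto
    let B : ℕ → σ → Matrix (Fin 2) (Fin 2) TT := fun N s =>
      !![((((N : ℝ) + 1)⁻¹ * m (A s 0 0) N : ℝ) : TT),
        ((((N : ℝ) + 1)⁻¹ * m (A s 0 1) N : ℝ) : TT);
        ⊥, ((((N : ℝ) + 1)⁻¹ * m (A s 1 1) N : ℝ) : TT)]
    have hB : ∀ s, TropTendsto (fun N => B N s) (A s) := by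
      intro s i j
      fin_cases i <;> fin_cases j
      · exact hm (A s 0 0)
      · exact hm (A s 0 1)
      · have : A s 1 0 = ⊥ := hA s 1 0 (by decide)
        simp [B, this]
      · exact hm (A s 1 1)
    have hwv : ∀ N, evalWord (B N) w = evalWord (B N) v := fun N =>
      evalWord_eq_of_int hw hv h (by positivity) _ _ _
    have hlim := TropTendsto.evalWord hB w
    simp only [hwv] at hlim
    exact hlim.eq (TropTendsto.evalWord hB v)
  · intro h a
    have := h (fun s => bicyclicMatrix 1 0 0 (a s)) fun s => isUT_of_fin_two
    rw [evalWord_bicyclicMatrix zero_le_one 0 (fun _ => 0) a hw,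
      evalWord_bicyclicMatrix zero_le_one 0 (fun _ => 0) a hv] at this
    exact bicyclicMatrix_injective (by simpa using this)
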